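/- arXiv:2405.20273 — 2 statements merged into one kernel-verified Lean document; each statement's English description precedes it below -/
import Mathlib

section
/- Every 2×2 complex unitary matrix U can be written as U = e^{iα} · Rz(β) · Rx(γ) · Rz(δ) for some real numbers α, β, γ, δ, where Rz(β) is the diagonal matrix with entries e^{-iβ/2} and e^{iβ/2}, and Rx(γ) is the matrix with diagonal entries cos(γ/2) and off-diagonal entries -i sin(γ/2). -/
/-- The single-qubit Rz gate: diag(e^{-iβ/2}, e^{iβ/2}). -/
noncomputable def Rz (β : ℝ) : Matrix (Fin 2) (Fin 2) ℂ :=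
  !![Complex.exp (-(Complex.I * ((β / 2 : ℝ) : ℂ))), 0;
     0, Complex.exp (Complex.I * ((β / 2 : ℝ) : ℂ))]

/-- The single-qubit Rx gate: diagonal entries cos(γ/2), off-diagonal entries -i sin(γ/2). -/
noncomputable def Rx (γ : ℝ) : Matrix (Fin 2) (Fin 2) ℂ :=
  !![(Real.cos (γ / 2) : ℂ), -(Complex.I * (Real.sin (γ / 2) : ℂ));
     -(Complex.I * (Real.sin (γ / 2) : ℂ)), (Real.cos (γ / 2) : ℂ)]

/-- The entries of `e^{iα} Rz(β) Rx(γ) Rz(δ)`. -/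
theorem exp_smul_Rz_mul_Rx_mul_Rz (α β γ δ : ℝ) :
    Complex.exp (Complex.I * (α : ℂ)) • (Rz β * Rx γ * Rz δ) =
      !![(Real.cos (γ / 2) : ℂ) * Complex.exp (((α - β / 2 - δ / 2 : ℝ) : ℂ) * Complex.I),
         -(Complex.I * (Real.sin (γ / 2) : ℂ)) *
          Complex.exp (((α - β / 2 + δ / 2 : ℝ) : ℂ) * Complex.I);
         -(Complex.I * (Real.sin (γ / 2) : ℂ)) *
          Complex.exp (((α + β / 2 - δ / 2 : ℝ) : ℂ) * Complex.I),
         (Real.cos (γ / 2) : ℂ) * Complex.exp (((α + β / 2 + δ / 2 : ℝ) : ℂ) * Complex.I)] := by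
  have exp_combine (x y z : ℝ) : Complex.exp (((x + y + z : ℝ) : ℂ) * Complex.I) =
      Complex.exp (Complex.I * x) * Complex.exp (Complex.I * y) * Complex.exp (Complex.I * z) := by
    rw [← Complex.exp_add, ← Complex.exp_add]
    congr 1
    push_cast
    ring
  have exp_neg_half (x : ℝ) : Complex.exp (-(Complex.I * ((x / 2 : ℝ) : ℂ))) =
      Complex.exp (Complex.I * ((-(x / 2) : ℝ) : ℂ)) := by
    congr 1
    push_cast
    ring
  simp only [sub_eq_add_neg, exp_combine, Rz, Rx, exp_neg_half]
  ext i j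
  fin_cases i <;> fin_cases j <;> simp <;> ring

/-- A `2 × 2` unitary matrix is determined by its first row and its determinant. -/
theorem second_row_of_mul_conjTranspose_eq_one {a b c d : ℂ}
    (h : !![a, b; c, d] * (!![a, b; c, d]).conjTranspose = 1) :
    ‖a‖ ^ 2 + ‖b‖ ^ 2 = 1 ∧ ‖a * d - b * c‖ = 1 ∧
      c = -(a * d - b * c) * star b ∧ d = (a * d - b * c) * star a := by
  have h00 : a * star a + b * star b = 1 := by
    simpa [Matrix.mul_apply, Fin.sum_univ_two] using congrFun (congrFun h 0) 0
  have h10 : c * star a + d * star b = 0 := by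
    simpa [Matrix.mul_apply, Fin.sum_univ_two] using congrFun (congrFun h 1) 0
  have hdet : (a * d - b * c) * star (a * d - b * c) = 1 := by
    simpa [Matrix.det_mul, Matrix.det_conjTranspose, Matrix.det_fin_two_of, -Matrix.cons_mul] using
      congrArg Matrix.det h
  refine ⟨?_, ?_, ?_, ?_⟩
  · simp only [Complex.star_def, Complex.mul_conj'] at h00
    exact_mod_cast h00
  · rw [Complex.star_def, Complex.mul_conj'] at hdet
    have hsq : ‖a * d - b * c‖ ^ 2 = 1 := by exact_mod_cast hdet
    exact (pow_eq_one_iff_of_nonneg (norm_nonneg _) two_ne_zero).1 hsq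
  · linear_combination (-c) * h00 + a * h10
  · linear_combination (-d) * h00 + b * h10

theorem star_eq_norm_mul_exp (z : ℂ) :
    star z = (‖z‖ : ℂ) * Complex.exp (((-z.arg : ℝ) : ℂ) * Complex.I) := by
  conv_lhs => rw [← Complex.norm_mul_exp_arg_mul_I z]
  simp only [Complex.star_def, map_mul, Complex.conj_ofReal, ← Complex.exp_conj, Complex.conj_I,
    Complex.ofReal_neg, mul_neg, neg_mul]

theorem stmt_4 (U : Matrix (Fin 2) (Fin 2) ℂ) (hU : U * U.conjTranspose = 1) :
    ∃ α β γ δ : ℝ,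
      U = Complex.exp (Complex.I * (α : ℂ)) • (Rz β * Rx γ * Rz δ) := by
  obtain ⟨a, b, c, d, rfl⟩ : ∃ a b c d : ℂ, U = !![a, b; c, d] :=
    ⟨_, _, _, _, Matrix.eta_fin_two U⟩
  obtain ⟨hrow, hdet, hc, hd⟩ := second_row_of_mul_conjTranspose_eq_one hU
  set D := a * d - b * c
  have hD : D = Complex.exp ((D.arg : ℂ) * Complex.I) := by
    simpa [hdet] using (Complex.norm_mul_exp_arg_mul_I D).symm
  have hcos : Real.cos (Real.arccos ‖a‖) = ‖a‖ :=
    Real.cos_arccos (by linarith [norm_nonneg a]) (by nlinarith [norm_nonneg a, sq_nonneg ‖b‖])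
  have hsin : Real.sin (Real.arccos ‖a‖) = ‖b‖ := by
    rw [Real.sin_arccos, show 1 - ‖a‖ ^ 2 = ‖b‖ ^ 2 by linarith, Real.sqrt_sq (norm_nonneg b)]
  have exp_add_half_pi (x : ℝ) : Complex.exp (((x + Real.pi / 2 : ℝ) : ℂ) * Complex.I) =
      Complex.exp ((x : ℂ) * Complex.I) * Complex.I := by
    push_cast
    rw [add_mul, Complex.exp_add, Complex.exp_pi_div_two_mul_I]
  have exp_sub_half_pi (x : ℝ) : Complex.exp (((x - Real.pi / 2 : ℝ) : ℂ) * Complex.I) =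
      -(Complex.exp ((x : ℂ) * Complex.I) * Complex.I) := by
    have h := exp_add_half_pi (x - Real.pi / 2)
    rw [sub_add_cancel] at h
    rw [h, mul_assoc, Complex.I_mul_I]
    ring
  have exp_add_real (x y : ℝ) : Complex.exp (((x + y : ℝ) : ℂ) * Complex.I) =
      Complex.exp ((x : ℂ) * Complex.I) * Complex.exp ((y : ℂ) * Complex.I) := by
    rw [← Complex.exp_add]
    push_cast
    ring_nf
  refine ⟨D.arg / 2, D.arg - a.arg - b.arg - Real.pi / 2, 2 * Real.arccos ‖a‖,
    b.arg + Real.pi / 2 - a.arg, ?_⟩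
  rw [exp_smul_Rz_mul_Rx_mul_Rz, mul_div_cancel_left₀ (Real.arccos ‖a‖) two_ne_zero, hcos, hsin]
  congr 1
  ext i j
  fin_cases i <;> fin_cases j <;> simp only [Fin.zero_eta, Fin.mk_one,
    Matrix.cons_val_zero, Matrix.cons_val_one, Fin.isValue]
  · rw [show D.arg / 2 - (D.arg - a.arg - b.arg - Real.pi / 2) / 2
      - (b.arg + Real.pi / 2 - a.arg) / 2 = a.arg by ring, Complex.norm_mul_exp_arg_mul_I]
  · rw [show D.arg / 2 - (D.arg - a.arg - b.arg - Real.pi / 2) / 2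
      + (b.arg + Real.pi / 2 - a.arg) / 2 = b.arg + Real.pi / 2 by ring, exp_add_half_pi]
    linear_combination -Complex.norm_mul_exp_arg_mul_I b
      + ‖b‖ * Complex.exp (b.arg * Complex.I) * Complex.I_mul_I
  · rw [show D.arg / 2 + (D.arg - a.arg - b.arg - Real.pi / 2) / 2
      - (b.arg + Real.pi / 2 - a.arg) / 2 = D.arg + -b.arg - Real.pi / 2 by ring,
      exp_sub_half_pi, exp_add_real, ← hD, hc, star_eq_norm_mul_exp]
    linear_combination -(D * ‖b‖ * Complex.exp (((-b.arg : ℝ) : ℂ) * Complex.I)) * Complex.I_mul_I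
  · rw [show D.arg / 2 + (D.arg - a.arg - b.arg - Real.pi / 2) / 2
      + (b.arg + Real.pi / 2 - a.arg) / 2 = D.arg + -a.arg by ring,
      exp_add_real, ← hD, hd, star_eq_norm_mul_exp]
    ring
end

section
/- Let n ∈ ℕ and let x, y : Fin n → Bool be distinct bit strings. Then there exists a finite composition σ of CNOT permutations of the set Fin n → Bool such that σ(x) and σ(y) differ in exactly one bit position. (This is the CX conjugation step that brings two basis states of Hamming distance greater than 1 to Hamming distance 1.) -/
/-- The CNOT permutation with control `b` and target `c`, acting on bit strings:
replaces the bit at position `c` with the xor of the bits at positions `c` and `b`. -/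
def cnotFun (n : ℕ) (b c : Fin n) : (Fin n → Bool) → (Fin n → Bool) :=
  fun w => Function.update w c (xor (w c) (w b))

/-- If `x` and `y` differ at `b`, and elsewhere only inside `s`, then CNOTs controlled by `b`
remove every difference outside `b`. -/
theorem exists_cnot_list_ne_iff {n : ℕ} (b : Fin n) (s : Finset (Fin n)) (x y : Fin n → Bool)
    (hb : x b ≠ y b) (hs : ∀ c, c ≠ b → c ∉ s → x c = y c) :
    ∃ L : List ((Fin n → Bool) → (Fin n → Bool)),
      (∀ f ∈ L, ∃ b c : Fin n, b ≠ c ∧ f = cnotFun n b c) ∧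
      ∀ l, (L.foldl (fun w f => f w) x) l ≠ (L.foldl (fun w f => f w) y) l ↔ l = b := by
  induction s using Finset.induction_on generalizing x y with
  | empty =>
    refine ⟨[], by simp, fun l => ⟨fun h => ?_, fun h => h ▸ hb⟩⟩
    by_contra hl
    exact h (hs l hl (by simp))
  | insert c s _ ih =>
    by_cases h : c = b ∨ x c = y c
    · exact ih x y hb (by grind)
    · push Not at h
      obtain ⟨hcb, hc⟩ := h
      obtain ⟨L, hL, hL'⟩ := ih (cnotFun n b c x) (cnotFun n b c y)
        (by simpa [cnotFun, hcb.symm] using hb) (by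
          intro d hdb hds
          by_cases hdc : d = c
          · subst hdc
            revert hb hc
            simp only [cnotFun, Function.update_self]
            cases x b <;> cases y b <;> cases x d <;> cases y d <;> simp
          · simpa [cnotFun, hdc] using hs d hdb (by simp [hdc, hds]))
      refine ⟨cnotFun n b c :: L, ?_, by simpa using hL'⟩
      intro f hf
      rcases List.mem_cons.mp hf with rfl | hf
      · exact ⟨b, c, hcb.symm, rfl⟩
      · exact hL f hf

theorem stmt_8 (n : ℕ) (x y : Fin n → Bool) (hxy : x ≠ y) :
    ∃ L : List ((Fin n → Bool) → (Fin n → Bool)),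
      (∀ f ∈ L, ∃ b c : Fin n, b ≠ c ∧ f = cnotFun n b c) ∧
      ∃! l : Fin n,
        (L.foldl (fun w f => f w) x) l ≠ (L.foldl (fun w f => f w) y) l := by
  obtain ⟨b, hb⟩ := Function.ne_iff.mp hxy
  obtain ⟨L, hL, hL'⟩ := exists_cnot_list_ne_iff b Finset.univ x y hb (by simp)
  exact ⟨L, hL, b, (hL' b).mpr rfl, fun l hl => (hL' l).mp hl⟩
end
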